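/- arXiv:2502.01063 — 2 statements merged into one kernel-verified Lean document; each statement's English description precedes it below -/
import Mathlib

section
/- Let $w_-<w_m$ with $\delta_R=w_m-w_-$ and let $w_0$ be the tanh profile. Then for every real $p\ge 1$ and every $t\ge 0$, $\int_{\mathbb{R}} w_0'(y)^p\,(1+t\,w_0'(y))^{1-4p}\,dy\le\delta_R^{\,p}$. -/
open MeasureTheory

/-- The tanh profile `w₀(x) = (w_m + w_-)/2 + (w_m - w_-)/2 * tanh x`. -/
noncomputable def tanhProfile (wminus wm : ℝ) (x : ℝ) : ℝ :=
  (wm + wminus) / 2 + (wm - wminus) / 2 * Real.tanh x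

open Filter Topology

theorem Real.hasDerivAt_tanh_one_sub_sq (x : ℝ) :
    HasDerivAt Real.tanh (1 - Real.tanh x ^ 2) x := by
  have hc : Real.cosh x ≠ 0 := (Real.cosh_pos x).ne'
  have h := (Real.hasDerivAt_sinh x).div (Real.hasDerivAt_cosh x) hc
  have hfun : Real.tanh = Real.sinh / Real.cosh :=
    funext fun y => Real.tanh_eq_sinh_div_cosh y
  have hval : (Real.cosh x * Real.cosh x - Real.sinh x * Real.sinh x) / Real.cosh x ^ 2 =
      1 - Real.tanh x ^ 2 := by
    rw [Real.tanh_eq_sinh_div_cosh]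
    field_simp
  rwa [hval, ← hfun] at h

theorem Real.tendsto_tanh_atTop_one : Tendsto Real.tanh atTop (𝓝 1) := by
  have he : Tendsto (fun x : ℝ => Real.exp (-x) ^ 2) atTop (𝓝 0) := by
    simpa using Real.tendsto_exp_neg_atTop_nhds_zero.pow 2
  have h := (he.const_sub 1).div (he.const_add 1) (by norm_num)
  have hfun : Real.tanh =
      (fun x => 1 - Real.exp (-x) ^ 2) / (fun x => 1 + Real.exp (-x) ^ 2) := by
    funext x
    have hx := (Real.exp_pos x).ne'
    simp only [Pi.div_apply]
    rw [Real.tanh_eq, Real.exp_neg]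
    field_simp
  rw [hfun]
  simpa using h

theorem Real.tendsto_tanh_atBot_neg_one : Tendsto Real.tanh atBot (𝓝 (-1)) := by
  have h := (Real.tendsto_tanh_atTop_one.comp tendsto_neg_atBot_atTop).neg
  refine h.congr fun x => ?_
  simp [Real.tanh_neg]

theorem Real.integrable_one_sub_tanh_sq : Integrable fun x : ℝ => 1 - Real.tanh x ^ 2 := by
  have hpos (x : ℝ) : 0 ≤ 1 - Real.tanh x ^ 2 := by linarith [Real.tanh_sq_lt_one x]
  have hIoi : IntegrableOn (fun x : ℝ => 1 - Real.tanh x ^ 2) (Set.Ioi 0) :=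
    integrableOn_Ioi_deriv_of_nonneg' (fun x _ => Real.hasDerivAt_tanh_one_sub_sq x)
      (fun x _ => hpos x) Real.tendsto_tanh_atTop_one
  have hIio : IntegrableOn (fun x : ℝ => 1 - Real.tanh x ^ 2) (Set.Iio 0) := by
    rw [← neg_zero] at hIoi
    simpa [Real.tanh_neg] using hIoi.comp_neg_Iio
  rw [← integrableOn_univ, ← Set.Iic_union_Ioi (a := (0 : ℝ))]
  exact ((integrableOn_Iic_iff_integrableOn_Iio).2 hIio).union hIoi

theorem hasDerivAt_tanhProfile (wminus wm x : ℝ) :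
    HasDerivAt (tanhProfile wminus wm) ((wm - wminus) / 2 * (1 - Real.tanh x ^ 2)) x :=
  ((Real.hasDerivAt_tanh_one_sub_sq x).const_mul _).const_add _

theorem integrable_deriv_tanhProfile (wminus wm : ℝ) :
    Integrable (deriv (tanhProfile wminus wm)) := by
  rw [funext fun x => (hasDerivAt_tanhProfile wminus wm x).deriv]
  exact Real.integrable_one_sub_tanh_sq.const_mul _

theorem integral_deriv_tanhProfile (wminus wm : ℝ) :
    ∫ x, deriv (tanhProfile wminus wm) x = wm - wminus := by
  rw [integral_of_hasDerivAt_of_tendsto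
    (fun x => (hasDerivAt_tanhProfile wminus wm x).differentiableAt.hasDerivAt)
    (integrable_deriv_tanhProfile wminus wm)
    ((Real.tendsto_tanh_atBot_neg_one.const_mul _).const_add _)
    ((Real.tendsto_tanh_atTop_one.const_mul _).const_add _)]
  ring

/-- For every real `p ≥ 1` and every `t ≥ 0`,
`∫ w₀'(y)^p (1 + t w₀'(y))^(1-4p) dy ≤ δ_R^p`. -/
theorem stmt_2 (wminus wm : ℝ) (h : wminus < wm) (p t : ℝ) (hp : 1 ≤ p) (ht : 0 ≤ t) :
    ∫ y : ℝ, (deriv (tanhProfile wminus wm) y) ^ p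
        * (1 + t * deriv (tanhProfile wminus wm) y) ^ (1 - 4 * p)
      ≤ (wm - wminus) ^ p := by
  have hδ : 0 < wm - wminus := sub_pos.2 h
  have hpos (y : ℝ) : 0 < deriv (tanhProfile wminus wm) y := by
    rw [(hasDerivAt_tanhProfile wminus wm y).deriv]
    exact mul_pos (half_pos hδ) (sub_pos.2 (Real.tanh_sq_lt_one y))
  have hle (y : ℝ) : deriv (tanhProfile wminus wm) y ≤ wm - wminus := by
    rw [(hasDerivAt_tanhProfile wminus wm y).deriv]
    nlinarith [sq_nonneg (Real.tanh y)]
  have hsplit {a : ℝ} (ha : 0 < a) : a ^ p = a ^ (p - 1) * a := by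
    rw [Real.rpow_sub_one ha.ne', div_mul_cancel₀ _ ha.ne']
  calc ∫ y : ℝ, (deriv (tanhProfile wminus wm) y) ^ p
          * (1 + t * deriv (tanhProfile wminus wm) y) ^ (1 - 4 * p)
      ≤ ∫ y : ℝ, (wm - wminus) ^ (p - 1) * deriv (tanhProfile wminus wm) y := by
        refine integral_mono_of_nonneg (.of_forall fun y => ?_)
          ((integrable_deriv_tanhProfile wminus wm).const_mul _) (.of_forall fun y => ?_)
        · have := hpos y
          dsimp only [Pi.zero_apply]
          positivity
        · have hy := hpos y
          calc deriv (tanhProfile wminus wm) y ^ p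
                * (1 + t * deriv (tanhProfile wminus wm) y) ^ (1 - 4 * p)
              ≤ deriv (tanhProfile wminus wm) y ^ p := by
                refine mul_le_of_le_one_right (by positivity) ?_
                exact Real.rpow_le_one_of_one_le_of_nonpos
                  (le_add_of_nonneg_right (by positivity)) (by linarith)
            _ = deriv (tanhProfile wminus wm) y ^ (p - 1)
                * deriv (tanhProfile wminus wm) y := hsplit hy
            _ ≤ (wm - wminus) ^ (p - 1) * deriv (tanhProfile wminus wm) y := by
                have hp' : 0 ≤ p - 1 := sub_nonneg.2 hp
                gcongr
                exact hle y
    _ = (wm - wminus) ^ p := by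
        rw [integral_const_mul, integral_deriv_tanhProfile, ← hsplit hδ]
end

section
/- Let $w_-<w_m$ with $\delta_R=w_m-w_-$, let $w_0$ be the tanh profile, and let $w(t,x)=w_0(\Phi_t^{-1}(x))$ be the Burgers solution. Then for every $t\ge 0$ and every $x\le w_- t$, one has $0\le w(t,x)-w_-\le\delta_R\,e^{2(x-w_- t)}$ and $0<\partial_x w(t,x)\le 2\,\delta_R\,e^{2(x-w_- t)}$. -/
/-- The characteristic map `Φ_t(y) = y + t w₀(y)`. -/
noncomputable def charMap (wminus wm t : ℝ) (y : ℝ) : ℝ :=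
  y + t * tanhProfile wminus wm y

/-- The Burgers solution `w(t,x) = w₀(Φ_t⁻¹(x))`. -/
noncomputable def burgersSol (wminus wm : ℝ) (t x : ℝ) : ℝ :=
  tanhProfile wminus wm (Function.invFun (charMap wminus wm t) x)

theorem Real.hasStrictDerivAt_tanh (x : ℝ) :
    HasStrictDerivAt Real.tanh (1 - Real.tanh x ^ 2) x := by
  have hc : Real.cosh x ≠ 0 := (Real.cosh_pos x).ne'
  have hd := (Real.hasStrictDerivAt_sinh x).div (Real.hasStrictDerivAt_cosh x) hc
  have he : Real.tanh = Real.sinh / Real.cosh := by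
    funext y
    exact Real.tanh_eq_sinh_div_cosh y
  have hv : 1 - Real.tanh x ^ 2 =
      (Real.cosh x * Real.cosh x - Real.sinh x * Real.sinh x) / Real.cosh x ^ 2 := by
    rw [Real.tanh_eq_sinh_div_cosh]
    field_simp
  rw [hv, he]
  exact hd

theorem Real.one_add_tanh_le (x : ℝ) : 1 + Real.tanh x ≤ 2 * Real.exp (2 * x) := by
  have hp := Real.exp_pos x
  have hn := Real.exp_pos (-x)
  have hmul : Real.exp (2 * x) * Real.exp (-x) = Real.exp x := by
    rw [← Real.exp_add]
    ring_nf
  have h2 := Real.exp_pos (2 * x)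
  have hsum : 1 + Real.tanh x = 2 * Real.exp x / (Real.exp x + Real.exp (-x)) := by
    rw [Real.tanh_eq]
    field_simp
    ring
  rw [hsum, div_le_iff₀ (by positivity)]
  nlinarith [mul_pos h2 hp]

section Burgers

variable {wminus wm t : ℝ}

theorem hasStrictDerivAt_tanhProfile (wminus wm x : ℝ) :
    HasStrictDerivAt (tanhProfile wminus wm)
      ((wm - wminus) / 2 * (1 - Real.tanh x ^ 2)) x :=
  ((Real.hasStrictDerivAt_tanh x).const_mul _).const_add _

theorem hasStrictDerivAt_charMap (wminus wm t y : ℝ) :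
    HasStrictDerivAt (charMap wminus wm t)
      (1 + t * ((wm - wminus) / 2 * (1 - Real.tanh y ^ 2))) y :=
  (hasStrictDerivAt_id y).add ((hasStrictDerivAt_tanhProfile wminus wm y).const_mul t)

theorem lt_tanhProfile (h : wminus < wm) (x : ℝ) : wminus < tanhProfile wminus wm x := by
  unfold tanhProfile
  nlinarith [mul_pos (sub_pos.2 h) (neg_lt_iff_pos_add.1 (Real.neg_one_lt_tanh x))]

theorem tanhProfile_lt (h : wminus < wm) (x : ℝ) : tanhProfile wminus wm x < wm := by
  unfold tanhProfile
  nlinarith [mul_pos (sub_pos.2 h) (sub_pos.2 (Real.tanh_lt_one x))]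

theorem deriv_tanhProfile_pos (h : wminus < wm) (x : ℝ) :
    0 < (wm - wminus) / 2 * (1 - Real.tanh x ^ 2) :=
  mul_pos (half_pos (sub_pos.2 h)) (sub_pos.2 (Real.tanh_sq_lt_one x))

theorem tanhProfile_sub_le (h : wminus < wm) (x : ℝ) :
    tanhProfile wminus wm x - wminus ≤ (wm - wminus) * Real.exp (2 * x) := by
  unfold tanhProfile
  nlinarith [mul_le_mul_of_nonneg_left (Real.one_add_tanh_le x) (sub_pos.2 h).le]

theorem deriv_tanhProfile_le (h : wminus < wm) (x : ℝ) :
    (wm - wminus) / 2 * (1 - Real.tanh x ^ 2) ≤ 2 * (wm - wminus) * Real.exp (2 * x) := by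
  have hq : 1 - Real.tanh x ^ 2 ≤ 4 * Real.exp (2 * x) := by
    nlinarith [Real.one_add_tanh_le x, sq_nonneg (1 + Real.tanh x)]
  nlinarith [mul_le_mul_of_nonneg_left hq (sub_pos.2 h).le]

theorem strictMono_charMap (h : wminus < wm) (ht : 0 ≤ t) : StrictMono (charMap wminus wm t) := by
  refine strictMono_of_deriv_pos fun y => ?_
  rw [(hasStrictDerivAt_charMap wminus wm t y).hasDerivAt.deriv]
  have := mul_nonneg ht (deriv_tanhProfile_pos h y).le
  linarith

theorem surjective_charMap (h : wminus < wm) (ht : 0 ≤ t) :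
    Function.Surjective (charMap wminus wm t) := by
  have hc : Continuous (charMap wminus wm t) :=
    continuous_iff_continuousAt.2 fun y =>
      (hasStrictDerivAt_charMap wminus wm t y).hasDerivAt.continuousAt
  refine fun p => mem_range_of_exists_le_of_exists_ge hc ⟨p - t * wm, ?_⟩ ⟨p - t * wminus, ?_⟩
  · have := mul_le_mul_of_nonneg_left (tanhProfile_lt h (p - t * wm)).le ht
    unfold charMap
    linarith
  · have := mul_le_mul_of_nonneg_left (lt_tanhProfile h (p - t * wminus)).le ht
    unfold charMap
    linarith

theorem charMap_invFun (h : wminus < wm) (ht : 0 ≤ t) (x : ℝ) :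
    charMap wminus wm t (Function.invFun (charMap wminus wm t) x) = x :=
  Function.rightInverse_invFun (surjective_charMap h ht) x

theorem continuous_invFun_charMap (h : wminus < wm) (ht : 0 ≤ t) :
    Continuous (Function.invFun (charMap wminus wm t)) := by
  have hm := strictMono_charMap h ht
  refine Monotone.continuous_of_surjective (fun a b hab => ?_)
    (Function.invFun_surjective hm.injective)
  rwa [← hm.le_iff_le, charMap_invFun h ht, charMap_invFun h ht]

theorem invFun_charMap_le (h : wminus < wm) (ht : 0 ≤ t) (x : ℝ) :
    Function.invFun (charMap wminus wm t) x ≤ x - wminus * t := by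
  have hx := charMap_invFun h ht x
  set y := Function.invFun (charMap wminus wm t) x
  have := mul_le_mul_of_nonneg_left (lt_tanhProfile h y).le ht
  unfold charMap at hx
  linarith

theorem hasDerivAt_burgersSol (h : wminus < wm) (ht : 0 ≤ t) (x : ℝ) :
    HasDerivAt (burgersSol wminus wm t)
      ((wm - wminus) / 2 * (1 - Real.tanh (Function.invFun (charMap wminus wm t) x) ^ 2) /
        (1 + t * ((wm - wminus) / 2 *
          (1 - Real.tanh (Function.invFun (charMap wminus wm t) x) ^ 2)))) x := by
  set y := Function.invFun (charMap wminus wm t) x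
  have hpos := mul_nonneg ht (deriv_tanhProfile_pos h y).le
  have hinv := HasStrictDerivAt.of_local_left_inverse
    (continuous_invFun_charMap h ht).continuousAt (hasStrictDerivAt_charMap wminus wm t y)
    (by positivity) (Filter.Eventually.of_forall (charMap_invFun h ht))
  exact ((hasStrictDerivAt_tanhProfile wminus wm y).comp x hinv).hasDerivAt

end Burgers

/-- For every `t ≥ 0` and every `x ≤ w_- t`:
`0 ≤ w(t,x) - w_- ≤ δ_R e^{2(x - w_- t)}` and `0 < ∂ₓ w(t,x) ≤ 2 δ_R e^{2(x - w_- t)}`. -/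
theorem stmt_9 (wminus wm : ℝ) (h : wminus < wm) (t x : ℝ) (ht : 0 ≤ t) (hx : x ≤ wminus * t) :
    0 ≤ burgersSol wminus wm t x - wminus ∧
      burgersSol wminus wm t x - wminus ≤ (wm - wminus) * Real.exp (2 * (x - wminus * t)) ∧
      0 < deriv (fun ξ => burgersSol wminus wm t ξ) x ∧
      deriv (fun ξ => burgersSol wminus wm t ξ) x ≤
        2 * (wm - wminus) * Real.exp (2 * (x - wminus * t)) := by
  have hle := invFun_charMap_le h ht x
  have hexp : Real.exp (2 * Function.invFun (charMap wminus wm t) x) ≤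
      Real.exp (2 * (x - wminus * t)) := Real.exp_le_exp.2 (by linarith)
  rw [(hasDerivAt_burgersSol h ht x).deriv]
  unfold burgersSol
  set y := Function.invFun (charMap wminus wm t) x
  have hd : 0 < wm - wminus := sub_pos.2 h
  have hpos := deriv_tanhProfile_pos h y
  have htpos := mul_nonneg ht hpos.le
  refine ⟨(sub_pos.2 (lt_tanhProfile h y)).le, (tanhProfile_sub_le h y).trans (by gcongr),
    div_pos hpos (by linarith), ?_⟩
  exact (div_le_self hpos.le (by linarith)).trans ((deriv_tanhProfile_le h y).trans (by gcongr))
end
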